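/- arXiv:2307.09645 — 2 statements merged into one kernel-verified Lean document; each statement's English description precedes it below -/
import Mathlib

section
/- Let M be a positive monoid consisting of algebraic numbers. Then the set {e^m : m ∈ M} is linearly independent over ℕ, in the following sense: the natural semiring homomorphism from the monoid semiring ℕ₀[M] (the semiring of finite formal sums ∑ c_i x^{m_i} with coefficients c_i ∈ ℕ and exponents m_i ∈ M) to ℝ that sends x^m to e^m is injective. Consequently, ℕ₀[M] is isomorphic as a semiring to E(M), the subsemiring of ℝ additively generated by {e^m : m ∈ M}. -/
open Polynomial in
theorem exists_int_polynomial_forall_aeval_eq_zero {K : Type*} [Field K] [CharZero K]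
    (S : Finset K) (hS0 : 0 ∉ S) (halg : ∀ a ∈ S, IsAlgebraic ℤ a) :
    ∃ f : ℤ[X], f.eval 0 ≠ 0 ∧ ∀ a ∈ S, aeval a f = 0 := by
  have (a : K) (ha : a ∈ S) : ∃ q : ℤ[X], q.coeff 0 ≠ 0 ∧ aeval a q = 0 :=
    (halg a ha).exists_nonzero_coeff_and_aeval_eq_zero
      (mem_nonZeroDivisors_of_ne_zero fun h => hS0 (h ▸ ha))
  choose! q hq0 hq using this
  refine ⟨∏ a ∈ S, q a, ?_, fun a ha => ?_⟩
  · rw [eval_prod]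
    exact Finset.prod_ne_zero_iff.mpr fun a ha => by
      rw [← coeff_zero_eq_eval_zero]; exact hq0 a ha
  · rw [map_prod]
    exact Finset.prod_eq_zero ha (hq a ha)

open Polynomial in
theorem isIntegral_pow_mul_aeval {K : Type*} [CommRing K] {a : K} {d : ℤ}
    (ha : IsIntegral ℤ (d • a)) (g : ℤ[X]) {D : ℕ} (hD : g.natDegree ≤ D) :
    IsIntegral ℤ ((d : K) ^ D * aeval a g) := by
  rw [aeval_eq_sum_range, Finset.mul_sum]
  refine IsIntegral.sum _ fun i hi => ?_
  have hi : i ≤ D := (Nat.lt_succ_iff.mp (Finset.mem_range.mp hi)).trans hD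
  have h : (d : K) ^ D * g.coeff i • a ^ i =
      algebraMap ℤ K (g.coeff i * d ^ (D - i)) * (d • a) ^ i := by
    obtain ⟨k, rfl⟩ := Nat.exists_eq_add_of_le hi
    simp only [zsmul_eq_mul, add_tsub_cancel_left, eq_intCast, Int.cast_mul, Int.cast_pow]
    ring
  rw [h]
  exact isIntegral_algebraMap.mul (ha.pow i)

theorem exists_prime_pow_div_factorial_lt_one (A B : ℝ) (m : ℕ) :
    ∃ p, m < p ∧ p.Prime ∧ A * (B ^ p / (p - 1).factorial) < 1 := by
  have h := (FloorSemiring.tendsto_pow_div_factorial_atTop B).const_mul (A * B)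
  rw [mul_zero] at h
  obtain ⟨n, hn⟩ := Filter.eventually_atTop.mp (h.eventually (gt_mem_nhds one_pos))
  obtain ⟨p, hp, hp'⟩ := Nat.exists_infinite_primes (max n m + 1)
  obtain ⟨k, rfl⟩ := Nat.exists_eq_add_one_of_ne_zero hp'.ne_zero
  refine ⟨k + 1, by omega, hp', ?_⟩
  have := hn k (by omega)
  rw [Nat.add_sub_cancel, pow_succ]
  convert! this using 1
  ring

theorem exists_int_eq_of_isIntegral_of_fixed {K : Type*} [Field K] [Algebra ℚ K]
    [IsGalois ℚ K] {x : K} (hx : IsIntegral ℤ x) (hfix : ∀ σ : Gal(K/ℚ), σ x = x) :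
    ∃ n : ℤ, x = n := by
  obtain ⟨y, rfl⟩ := (InfiniteGalois.mem_range_algebraMap_iff_fixed x).mpr hfix
  have hy : IsIntegral ℤ y :=
    (isIntegral_algebraMap_iff (algebraMap ℚ K).injective).mp hx
  obtain ⟨n, rfl⟩ := IsIntegrallyClosed.isIntegral_iff.mp hy
  exact ⟨n, by simp⟩

open Polynomial in
theorem int_add_sum_exp_ne_zero {K : Type*} [Field K] [Algebra ℚ K] [IsGalois ℚ K]
    (ι : K →+* ℂ) (S : Finset K) (hS0 : 0 ∉ S) (c : K → ℤ)
    (hS : ∀ σ : Gal(K/ℚ), ∀ a ∈ S, σ a ∈ S) (hc : ∀ σ : Gal(K/ℚ), ∀ a, c (σ a) = c a)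
    {w : ℤ} (hw : w ≠ 0) :
    (w : ℂ) + ∑ a ∈ S, c a * Complex.exp (ι a) ≠ 0 := by
  intro hsum
  have : CharZero K := algebraRat.charZero K
  have : Algebra.IsAlgebraic ℤ K :=
    (IsFractionRing.comap_isAlgebraic_iff (A := ℤ) (K := ℚ) (C := K)).mpr inferInstance
  obtain ⟨f, hf0, hf⟩ := exists_int_polynomial_forall_aeval_eq_zero S hS0
    fun a _ => Algebra.IsAlgebraic.isAlgebraic a
  obtain ⟨d, hd0, hd⟩ := Algebra.IsAlgebraic.exists_integral_multiples ℤ S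
  obtain ⟨b, hb⟩ := LindemannWeierstrass.exp_polynomial_approx f hf0
  obtain ⟨p, hpm, hp, hlt⟩ := exists_prime_pow_div_factorial_lt_one
    (∑ a ∈ S, |(c a : ℝ)|) (|(d : ℝ)| ^ f.natDegree * b)
    (max (f.eval 0).natAbs (max d.natAbs w.natAbs))
  obtain ⟨n, hpn, g, hg, happrox⟩ := hb p (by omega) hp
  set D := f.natDegree * p
  have hgD : g.natDegree ≤ D := by rw [mul_comm] at hg; omega
  obtain ⟨t, ht⟩ : ∃ t : ℤ, (d : K) ^ D * ∑ a ∈ S, c a * aeval a g = t := by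
    refine exists_int_eq_of_isIntegral_of_fixed ?_ fun σ => ?_
    · rw [Finset.mul_sum]
      refine IsIntegral.sum _ fun a ha => ?_
      rw [mul_left_comm]
      exact (isIntegral_algebraMap (R := ℤ) (x := c a)).mul
        (isIntegral_pow_mul_aeval (hd a ha) g hgD)
    · rw [map_mul, map_pow, map_intCast, map_sum]
      congr 1
      refine Finset.sum_nbij σ (hS σ) σ.injective.injOn (fun a ha => ?_) fun a _ => ?_
      · exact ⟨σ.symm a, hS σ.symm a ha, σ.apply_symm_apply a⟩
      · rw [map_mul, map_intCast, hc]
        congr 1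
        exact (aeval_algHom_apply (σ.toAlgHom.restrictScalars ℤ) a g).symm
  have ht' : (d : ℂ) ^ D * ∑ a ∈ S, c a * aeval (ι a) g = t := by
    have := congrArg ι ht
    simp only [map_mul, map_pow, map_intCast, map_sum] at this
    rw [← this]
    congr 1
    exact Finset.sum_congr rfl fun a _ => by
      rw [show ι a = ι.toIntAlgHom a from rfl, aeval_algHom_apply]; rfl
  have hndvd : ¬ (p : ℤ) ∣ d ^ D * n * w + p * t := by
    rw [dvd_add_left (dvd_mul_right _ _)]
    have hpi := Nat.prime_iff_prime_int.mp hp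
    have hlt_ndvd {z : ℤ} (hz : z ≠ 0) (hzp : z.natAbs < p) : ¬ (p : ℤ) ∣ z := fun h =>
      hzp.not_ge (Nat.le_of_dvd (Int.natAbs_pos.mpr hz) (Int.natCast_dvd.mp h))
    intro h
    rcases hpi.dvd_or_dvd h with h | h
    · rcases hpi.dvd_or_dvd h with h | h
      · exact hlt_ndvd hd0 (by omega) (hpi.dvd_of_dvd_pow h)
      · exact hpn h
    · exact hlt_ndvd hw (by omega) h
  have hone : (1 : ℝ) ≤ ‖((d ^ D * n * w + p * t : ℤ) : ℂ)‖ := by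
    rw [Complex.norm_intCast]
    exact_mod_cast Int.one_le_abs fun h => hndvd (by rw [h]; exact dvd_zero _)
  have hkey : ((d ^ D * n * w + p * t : ℤ) : ℂ) =
      -((d : ℂ) ^ D * ∑ a ∈ S, c a * (n • Complex.exp (ι a) - p • aeval (ι a) g)) := by
    have h1 : ∑ a ∈ S, (c a : ℂ) * (n • Complex.exp (ι a) - p • aeval (ι a) g) =
        n * ∑ a ∈ S, c a * Complex.exp (ι a) - p * ∑ a ∈ S, c a * aeval (ι a) g := by
      rw [Finset.mul_sum, Finset.mul_sum, ← Finset.sum_sub_distrib]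
      exact Finset.sum_congr rfl fun a _ => by simp only [zsmul_eq_mul, nsmul_eq_mul]; ring
    rw [h1]
    push_cast
    rw [← ht']
    linear_combination (d : ℂ) ^ D * n * hsum
  refine absurd hone (not_le.mpr ?_)
  rw [hkey, norm_neg, norm_mul, norm_pow, Complex.norm_intCast]
  refine lt_of_le_of_lt ?_ hlt
  rw [mul_pow, ← pow_mul, mul_div_assoc, mul_left_comm, Finset.sum_mul]
  refine mul_le_mul_of_nonneg_left ((norm_sum_le _ _).trans (Finset.sum_le_sum fun a ha => ?_))
    (by positivity)
  rw [norm_mul, Complex.norm_intCast]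
  refine mul_le_mul_of_nonneg_left (happrox ?_) (abs_nonneg _)
  rw [mem_aroots]
  refine ⟨fun h => hf0 (by simp [h]), ?_⟩
  rw [show ι a = ι.toIntAlgHom a from rfl, aeval_algHom_apply, hf a ha, map_zero]

/-- The ring homomorphism from the group algebra `ℤ[K]` to `ℂ` sending `x^a` to `exp (ι a)`. -/
noncomputable def AddMonoidAlgebra.evalExp {K : Type*} [Field K] (ι : K →+* ℂ) :
    AddMonoidAlgebra ℤ K →ₐ[ℤ] ℂ :=
  AddMonoidAlgebra.lift ℤ ℂ K
    (Complex.expMonoidHom.comp (AddMonoidHom.toMultiplicative (ι : K →+ ℂ)))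

theorem AddMonoidAlgebra.evalExp_apply {K : Type*} [Field K] (ι : K →+* ℂ)
    (f : AddMonoidAlgebra ℤ K) :
    evalExp ι f = ∑ a ∈ f.coeff.support, f.coeff a * Complex.exp (ι a) := by
  simp [evalExp, AddMonoidAlgebra.lift_apply, Finsupp.sum]

theorem AddMonoidAlgebra.evalExp_ne_zero_of_coeff_zero_ne_zero {K : Type*} [Field K] [Algebra ℚ K]
    [IsGalois ℚ K] (ι : K →+* ℂ) {f : AddMonoidAlgebra ℤ K}
    (hfix : ∀ σ : Gal(K/ℚ), ∀ a, f.coeff (σ a) = f.coeff a) (h0 : f.coeff 0 ≠ 0) :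
    evalExp ι f ≠ 0 := by
  classical
  rw [evalExp_apply, ← Finset.add_sum_erase _ _ (Finsupp.mem_support_iff.mpr h0), map_zero ι,
    Complex.exp_zero, mul_one]
  refine int_add_sum_exp_ne_zero ι _ (Finset.notMem_erase _ _) _ (fun σ a ha => ?_) hfix h0
  simpa [hfix] using ha

theorem AddMonoidAlgebra.evalExp_injective {K : Type*} [Field K] [Algebra ℚ K]
    [FiniteDimensional ℚ K] [IsGalois ℚ K] (ι : K →+* ℂ) :
    Function.Injective (evalExp ι) := by
  rw [injective_iff_map_eq_zero]
  intro f hf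
  by_contra hne
  let act (σ : Gal(K/ℚ)) : AddMonoidAlgebra ℤ K ≃+* AddMonoidAlgebra ℤ K :=
    mapDomainRingEquiv ℤ (σ : K ≃+ K)
  have coeff_act (σ : Gal(K/ℚ)) (g : AddMonoidAlgebra ℤ K) (a : K) :
      (act σ g).coeff (σ a) = g.coeff a := by
    simp only [act, coeff_mapDomainRingEquiv, Finsupp.equivMapDomain_apply]
    exact congrArg _ (σ.symm_apply_apply a)
  have act_mul (σ τ : Gal(K/ℚ)) (g : AddMonoidAlgebra ℤ K) : act σ (act τ g) = act (σ * τ) g := by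
    ext a
    obtain ⟨b, rfl⟩ := (σ * τ).surjective a
    rw [coeff_act, AlgEquiv.mul_apply, coeff_act, coeff_act]
  have coeff_of_fixed {g : AddMonoidAlgebra ℤ K} (hg : ∀ σ, act σ g = g) (σ : Gal(K/ℚ)) (a : K) :
      g.coeff (σ a) = g.coeff a := by
    conv_lhs => rw [← hg σ, coeff_act]
  let F := ∏ σ : Gal(K/ℚ), act σ f
  have hF0 : F ≠ 0 := Finset.prod_ne_zero_iff.mpr fun σ _ => by simpa using hne
  have hF (τ : Gal(K/ℚ)) : act τ F = F := by
    rw [map_prod]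
    simp only [act_mul]
    exact Fintype.prod_equiv (Equiv.mulLeft τ) _ _ fun _ => rfl
  have hevalF : evalExp ι F = 0 := by
    rw [map_prod]
    refine Finset.prod_eq_zero (Finset.mem_univ 1) ?_
    rw [show act 1 f = f from AddMonoidAlgebra.ext (Finsupp.ext fun a => coeff_act 1 f a), hf]
  obtain ⟨a, ha⟩ : ∃ a, F.coeff a ≠ 0 := by
    by_contra! h
    exact hF0 (AddMonoidAlgebra.ext (Finsupp.ext h))
  let s := ∑ σ : Gal(K/ℚ), single (σ (-a)) (1 : ℤ)
  have hs (τ : Gal(K/ℚ)) : act τ s = s := by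
    rw [map_sum]
    refine Fintype.sum_equiv (Equiv.mulLeft τ) _ _ fun σ => ?_
    simp only [act, mapDomainRingEquiv_single]
    rfl
  refine evalExp_ne_zero_of_coeff_zero_ne_zero ι (f := F * s)
    (coeff_of_fixed fun σ => by rw [map_mul, hF, hs]) ?_ (by rw [map_mul, hevalF, zero_mul])
  have : (F * s).coeff 0 = Fintype.card Gal(K/ℚ) * F.coeff a := by
    rw [Finset.mul_sum, coeff_sum, Finset.sum_apply']
    simp [coeff_mul_single_apply, coeff_of_fixed hF]
  rw [this]
  exact mul_ne_zero (by simp) ha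

theorem exists_isGalois_intermediateField_of_isAlgebraic {F L : Type*} [Field F] [CharZero F]
    [Field L] [Algebra F L] [IsAlgClosed L] (s : Finset L) (hs : ∀ a ∈ s, IsAlgebraic F a) :
    ∃ K : IntermediateField F L, FiniteDimensional F K ∧ IsGalois F K ∧ ∀ a ∈ s, a ∈ K := by
  let p : Polynomial F := ∏ a ∈ s, minpoly F a
  have hp0 : p ≠ 0 := Finset.prod_ne_zero_iff.mpr fun a ha => minpoly.ne_zero (hs a ha).isIntegral
  have hsplit := IntermediateField.adjoin_rootSet_isSplittingField (p := p)
    (IsAlgClosed.splits (p.map (algebraMap F L)))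
  have hfin := Polynomial.IsSplittingField.finiteDimensional
    (IntermediateField.adjoin F (p.rootSet L)) p
  have hnormal := Normal.of_isSplittingField (F := F)
    (E := IntermediateField.adjoin F (p.rootSet L)) p
  refine ⟨IntermediateField.adjoin F (p.rootSet L), hfin, ⟨⟩, fun a ha => ?_⟩
  refine IntermediateField.subset_adjoin _ _ ((Polynomial.mem_rootSet_of_ne hp0).mpr ?_)
  rw [map_prod]
  exact Finset.prod_eq_zero ha (minpoly.aeval F a)

/-- **Lindemann-Weierstrass theorem** with integer coefficients. -/
theorem linearIndependent_int_cexp_of_isAlgebraic :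
    LinearIndependent ℤ fun a : {a : ℂ // IsAlgebraic ℚ a} => Complex.exp a := by
  rw [linearIndependent_iff']
  intro s g hsum a ha
  obtain ⟨K, hfin, hgal, hK⟩ := exists_isGalois_intermediateField_of_isAlgebraic (F := ℚ)
    (s.map (Function.Embedding.subtype _)) (by simp +contextual)
  have hmem (b : s) : (b : ℂ) ∈ K := hK _ (Finset.mem_map_of_mem _ b.2)
  let f : AddMonoidAlgebra ℤ K :=
    ∑ b : s, AddMonoidAlgebra.single (⟨b, hmem b⟩ : K) (g b)
  have hf : f = 0 := by
    apply @AddMonoidAlgebra.evalExp_injective K _ K.algebra' hfin hgal (algebraMap K ℂ)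
    rw [map_zero, ← hsum, ← Finset.sum_coe_sort, map_sum]
    exact Finset.sum_congr rfl fun b _ => by simp [AddMonoidAlgebra.evalExp]
  have hcoeff : f.coeff ⟨a, hmem ⟨a, ha⟩⟩ = g a := by
    rw [AddMonoidAlgebra.coeff_sum, Finset.sum_apply', Finset.sum_eq_single ⟨a, ha⟩]
    · simp
    · intro b _ hb
      have : (b : ℂ) ≠ a := fun h => hb (Subtype.ext (Subtype.ext h))
      simp [this]
    · simp
  rw [← hcoeff, hf]
  rfl

theorem linearIndependent_nat_exp_of_isAlgebraic {s : Set ℝ} (halg : ∀ x ∈ s, IsAlgebraic ℚ x) :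
    LinearIndependent ℕ fun x : s => Real.exp x := by
  have hinj : Function.Injective fun x : s =>
      (⟨(x : ℝ), (halg x x.2).algebraMap⟩ : {a : ℂ // IsAlgebraic ℚ a}) :=
    fun x y h => Subtype.ext (Complex.ofReal_injective (congrArg Subtype.val h))
  have hint : LinearIndependent ℤ fun x : s => Real.exp x := by
    refine LinearIndependent.of_comp Complex.ofRealHom.toIntAlgHom.toLinearMap ?_
    convert! linearIndependent_int_cexp_of_isAlgebraic.comp _ hinj using 1
    ext x
    simp
  exact hint.restrict_scalars fun m n h => by simpa using h


/-- For a positive monoid `M` of algebraic numbers, the natural semiring homomorphism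
from the monoid semiring `ℕ₀[M]` to `ℝ` sending `x^m` to `e^m` is injective, and its
range is exactly the exponentiation semiring `E(M)`; consequently `ℕ₀[M]` is
isomorphic as a semiring to `E(M)`. -/
theorem monoidSemiring_iso_exponentiation_semiring
    (M : AddSubmonoid ℝ) (hpos : ∀ x ∈ M, (0 : ℝ) ≤ x)
    (halg : ∀ x ∈ M, IsAlgebraic ℚ x) :
    ∃ φ : AddMonoidAlgebra ℕ M →+* ℝ,
      (∀ m : M, φ (AddMonoidAlgebra.single m 1) = Real.exp (m : ℝ)) ∧
      Function.Injective φ ∧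
      Set.range φ = (AddSubmonoid.closure (Real.exp '' (M : Set ℝ)) : Set ℝ) ∧
      Nonempty (AddMonoidAlgebra ℕ M ≃+* φ.rangeS) := by
  let φ : AddMonoidAlgebra ℕ M →ₐ[ℕ] ℝ := AddMonoidAlgebra.lift ℕ ℝ M
    (Real.expMonoidHom.comp (AddMonoidHom.toMultiplicative M.subtype))
  have hφ (m : M) (n : ℕ) : φ (AddMonoidAlgebra.single m n) = n * Real.exp (m : ℝ) := by
    simp [φ]
  have hinj : Function.Injective φ := by
    intro f g hfg
    refine AddMonoidAlgebra.coeff_injective (linearIndependent_nat_exp_of_isAlgebraic halg ?_)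
    simpa [φ, AddMonoidAlgebra.lift_apply, Finsupp.linearCombination_apply] using hfg
  refine ⟨φ, fun m => by simpa using hφ m 1, hinj, ?_, ⟨?_⟩⟩
  · apply Set.Subset.antisymm
    · rintro _ ⟨f, rfl⟩
      simp only [φ, RingHom.coe_coe, AddMonoidAlgebra.lift_apply]
      exact sum_mem fun m _ => nsmul_mem
        (AddSubmonoid.subset_closure (Set.mem_image_of_mem _ m.2)) _
    · have : AddSubmonoid.closure (Real.exp '' (M : Set ℝ)) ≤ AddMonoidHom.mrange φ := by
        rw [AddSubmonoid.closure_le]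
        rintro _ ⟨m, hm, rfl⟩
        exact ⟨AddMonoidAlgebra.single ⟨m, hm⟩ 1, by simpa using hφ ⟨m, hm⟩ 1⟩
      exact this
  · exact RingEquiv.ofBijective (φ : AddMonoidAlgebra ℕ M →+* ℝ).rangeSRestrict
      ⟨fun f g h => hinj (congrArg Subtype.val h), RingHom.rangeSRestrict_surjective _⟩
end

section
/- Let (p_n)_{n≥1} be a strictly increasing sequence of prime numbers, set a_n := 1 + (-1)^n / p_n for each n ∈ ℕ, and let M be the positive monoid generated by {a_n : n ∈ ℕ}. Then every nonzero q ∈ M is divisible in M by only finitely many atoms of M (i.e., only finitely many atoms a satisfy q − a ∈ M), and consequently M is a finite factorization monoid (FFM). -/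
/-- `a` is an (additive) atom of the set `M ⊆ ℝ`. -/
def IsAddAtom (M : Set ℝ) (a : ℝ) : Prop :=
  a ∈ M ∧ a ≠ 0 ∧ ∀ b ∈ M, ∀ c ∈ M, a = b + c → b = 0 ∨ c = 0

/-- The factorizations of `x` in `M`: multisets of atoms of `M` summing to `x`. -/
def AddFactorizations (M : Set ℝ) (x : ℝ) : Set (Multiset ℝ) :=
  {s | (∀ a ∈ s, IsAddAtom M a) ∧ s.sum = x}

/-- `M` is atomic: every nonzero element has a factorization into atoms. -/
def IsAddAtomic (M : Set ℝ) : Prop :=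
  ∀ x ∈ M, x ≠ 0 → (AddFactorizations M x).Nonempty

/-- `M` is a finite factorization monoid: it is atomic and every element has only
finitely many factorizations. -/
def IsFFM (M : Set ℝ) : Prop :=
  IsAddAtomic M ∧ ∀ x ∈ M, (AddFactorizations M x).Finite

/-- Every element of the submonoid generated by the `a n` with `n ∈ S` is a sum of such `a n`. -/
theorem exists_index_multiset_of_mem_closure {a : ℕ → ℝ} {S : Set ℕ} {x : ℝ}
    (hx : x ∈ AddSubmonoid.closure (a '' S)) :
    ∃ t : Multiset ℕ, (∀ n ∈ t, n ∈ S) ∧ (t.map a).sum = x := by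
  induction hx using AddSubmonoid.closure_induction with
  | mem x hx =>
    obtain ⟨n, hn, rfl⟩ := hx
    exact ⟨{n}, by simpa using hn, by simp⟩
  | zero => exact ⟨0, by simp, by simp⟩
  | add x y _ _ hx hy =>
    obtain ⟨s, hs, rfl⟩ := hx
    obtain ⟨t, ht, rfl⟩ := hy
    refine ⟨s + t, fun n hn => ?_, by simp⟩
    rcases Multiset.mem_add.1 hn with h | h
    exacts [hs n h, ht n h]

/-- An atom of the submonoid generated by `S` lies in `S`. -/
theorem IsAddAtom.mem_of_closure {S : Set ℝ} {x : ℝ}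
    (hx : IsAddAtom (AddSubmonoid.closure S : Set ℝ) x) : x ∈ S := by
  obtain ⟨hxM, hx0, hxa⟩ := hx
  revert hx0 hxa
  induction hxM using AddSubmonoid.closure_induction with
  | mem x hx => exact fun _ _ => hx
  | zero => exact fun h => absurd rfl h
  | add x y hx hy ihx ihy =>
    intro h0 hxa
    rcases hxa x hx y hy rfl with rfl | rfl
    · rw [zero_add] at h0 hxa ⊢
      exact ihy h0 hxa
    · rw [add_zero] at h0 hxa ⊢
      exact ihx h0 hxa

/-- A submonoid of `ℝ` whose nonzero elements are bounded below by some `ε > 0` is atomic. -/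
theorem isAddAtomic_of_forall_le {M : AddSubmonoid ℝ} {ε : ℝ} (hε : 0 < ε)
    (hM : ∀ x ∈ M, x ≠ 0 → ε ≤ x) : IsAddAtomic (M : Set ℝ) := by
  have key : ∀ n : ℕ, ∀ x ∈ M, x ≠ 0 → x ≤ n * ε →
      (AddFactorizations (M : Set ℝ) x).Nonempty := by
    intro n
    induction n with
    | zero =>
      intro x hx h0 hle
      have := hM x hx h0
      simp at hle
      linarith
    | succ n ih =>
      intro x hx h0 hle
      by_cases hat : IsAddAtom (M : Set ℝ) x
      · exact ⟨{x}, by simpa using hat, by simp⟩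
      · obtain ⟨b, hb, c, hc, rfl, hb0, hc0⟩ :
            ∃ b ∈ M, ∃ c ∈ M, x = b + c ∧ b ≠ 0 ∧ c ≠ 0 := by
          by_contra! h
          refine hat ⟨hx, h0, fun b hb c hc hxe => ?_⟩
          by_cases hb0 : b = 0
          · exact Or.inl hb0
          · exact Or.inr (h b hb c hc hxe hb0)
        have hbε := hM b hb hb0
        have hcε := hM c hc hc0
        push_cast at hle
        obtain ⟨s, hs, hsb⟩ := ih b hb hb0 (by linarith)
        obtain ⟨t, ht, htc⟩ := ih c hc hc0 (by linarith)
        refine ⟨s + t, fun y hy => ?_, by rw [Multiset.sum_add, hsb, htc]⟩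
        rcases Multiset.mem_add.1 hy with h | h
        exacts [hs y h, ht y h]
  intro x hx h0
  obtain ⟨n, hn⟩ := exists_nat_ge (x / ε)
  exact key n x hx h0 ((div_le_iff₀ hε).1 hn)

/-- There are finitely many multisets of bounded cardinality with elements in a finite set. -/
theorem finite_multiset_card_le {α : Type*} {F : Set α} (hF : F.Finite) (N : ℕ) :
    {s : Multiset α | (∀ x ∈ s, x ∈ F) ∧ s.card ≤ N}.Finite := by
  classical
  refine (Set.finite_Iic (N • hF.toFinset.val)).subset fun s ⟨hs, hN⟩ => ?_
  refine Multiset.le_iff_count.2 fun x => ?_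
  by_cases hx : x ∈ s
  · rw [Multiset.count_nsmul, Multiset.count_eq_one_of_mem hF.toFinset.nodup
      (by simpa using hs x hx), mul_one]
    exact (Multiset.count_le_card x s).trans hN
  · simp [Multiset.count_eq_zero_of_notMem hx]

/-- If the nonzero elements of a submonoid of `ℝ` are bounded below by some `ε > 0` and each
element is divisible by finitely many atoms, then the submonoid is an FFM. -/
theorem isFFM_of_finite_atoms {M : AddSubmonoid ℝ} {ε : ℝ} (hε : 0 < ε)
    (hM : ∀ x ∈ M, x ≠ 0 → ε ≤ x)
    (hfin : ∀ q ∈ M, {x : ℝ | IsAddAtom (M : Set ℝ) x ∧ q - x ∈ M}.Finite) :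
    IsFFM (M : Set ℝ) := by
  refine ⟨isAddAtomic_of_forall_le hε hM, fun q hq => ?_⟩
  obtain ⟨N, hN⟩ := exists_nat_ge (q / ε)
  refine (finite_multiset_card_le (hfin q hq) N).subset fun s ⟨hs, hsq⟩ => ⟨fun x hx => ?_, ?_⟩
  · refine ⟨hs x hx, ?_⟩
    obtain ⟨t, rfl⟩ := Multiset.exists_cons_of_mem hx
    rw [← hsq, Multiset.sum_cons, add_sub_cancel_left]
    exact M.multiset_sum_mem t fun y hy => (hs y (Multiset.mem_cons_of_mem hy)).1
  · have h := Multiset.card_nsmul_le_sum (s := s) (a := ε)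
      fun x hx => hM x (hs x hx).1 (hs x hx).2.1
    rw [hsq, nsmul_eq_mul, ← le_div_iff₀ hε] at h
    exact_mod_cast h.trans hN

/-- The real numbers of the form `z / d` with `z` an integer and `d` a natural number
not divisible by the prime `ℓ`. -/
def primeToDenom (ℓ : ℕ) (hℓ : ℓ.Prime) : AddSubgroup ℝ where
  carrier := {x | ∃ d : ℕ, ¬ ℓ ∣ d ∧ ∃ z : ℤ, d * x = z}
  zero_mem' := ⟨1, hℓ.one_lt.ne' ∘ Nat.dvd_one.1, 0, by simp⟩
  add_mem' := by
    rintro x y ⟨d, hd, z, hz⟩ ⟨e, he, w, hw⟩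
    refine ⟨d * e, hℓ.not_dvd_mul hd he, e * z + d * w, ?_⟩
    push_cast
    rw [← hz, ← hw]
    ring
  neg_mem' := by
    rintro x ⟨d, hd, z, hz⟩
    exact ⟨d, hd, -z, by push_cast; rw [← hz]; ring⟩

theorem dvd_of_div_mem_primeToDenom {ℓ : ℕ} (hℓ : ℓ.Prime) {c : ℕ}
    (h : (c : ℝ) / ℓ ∈ primeToDenom ℓ hℓ) : ℓ ∣ c := by
  obtain ⟨d, hd, z, hz⟩ := h
  have hℓ0 : (ℓ : ℝ) ≠ 0 := by exact_mod_cast hℓ.ne_zero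
  have hR : (d : ℝ) * c = ℓ * z := by
    rw [← hz]
    field_simp
  have hZ : ((d * c : ℕ) : ℤ) = ℓ * z := by exact_mod_cast hR
  exact (hℓ.dvd_mul.1 (Int.natCast_dvd_natCast.1 ⟨z, hZ⟩)).resolve_left hd

section AlternatingPrime

variable {p : ℕ → ℕ} {a : ℕ → ℝ}

theorem prime_mul_alternating (hp : ∀ n ∈ Set.Ici 1, (p n).Prime)
    (ha : ∀ n, a n = 1 + (-1) ^ n / (p n : ℝ)) {n : ℕ} (hn : n ∈ Set.Ici 1) :
    (p n : ℝ) * a n = ((p n + (-1) ^ n : ℤ) : ℝ) := by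
  have h0 : (p n : ℝ) ≠ 0 := by exact_mod_cast (hp n hn).ne_zero
  rw [ha]
  push_cast
  field_simp

theorem half_le_alternating (hp : ∀ n ∈ Set.Ici 1, (p n).Prime)
    (ha : ∀ n, a n = 1 + (-1) ^ n / (p n : ℝ)) {n : ℕ} (hn : n ∈ Set.Ici 1) :
    1 / 2 ≤ a n := by
  have h2 : (2 : ℝ) ≤ p n := by exact_mod_cast (hp n hn).two_le
  have hinv : 1 / (p n : ℝ) ≤ 1 / 2 := one_div_le_one_div_of_le two_pos h2
  have hpos : 0 ≤ 1 / (p n : ℝ) := by positivity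
  rw [ha]
  rcases neg_one_pow_eq_or ℝ n with h | h <;> rw [h]
  · linarith
  · rw [neg_div]
    linarith

theorem card_le_two_mul_sum (hp : ∀ n ∈ Set.Ici 1, (p n).Prime)
    (ha : ∀ n, a n = 1 + (-1) ^ n / (p n : ℝ)) {t : Multiset ℕ}
    (ht : ∀ n ∈ t, n ∈ Set.Ici 1) : (t.card : ℝ) ≤ 2 * (t.map a).sum := by
  have h : ∀ x ∈ t.map a, 1 / 2 ≤ x := by
    intro x hx
    obtain ⟨n, hn, rfl⟩ := Multiset.mem_map.1 hx
    exact half_le_alternating hp ha (ht n hn)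
  have := Multiset.card_nsmul_le_sum h
  rw [Multiset.card_map, nsmul_eq_mul] at this
  linarith

/-- The `p N`-part of the denominator of a sum of `a n`s only comes from the copies of `a N`. -/
theorem sum_sub_count_mem_primeToDenom (hp : ∀ n ∈ Set.Ici 1, (p n).Prime)
    (hinj : Set.InjOn p (Set.Ici 1)) (ha : ∀ n, a n = 1 + (-1) ^ n / (p n : ℝ))
    {N : ℕ} (hN : N ∈ Set.Ici 1) {t : Multiset ℕ} (ht : ∀ n ∈ t, n ∈ Set.Ici 1) :
    (t.map a).sum - (-1) ^ N * (t.count N / (p N : ℝ)) ∈ primeToDenom (p N) (hp N hN) := by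
  induction t using Multiset.induction_on with
  | empty => simp
  | cons n t ih =>
    have ht' := ih fun m hm => ht m (Multiset.mem_cons_of_mem hm)
    have hn := ht n (Multiset.mem_cons_self n t)
    rw [Multiset.map_cons, Multiset.sum_cons]
    by_cases h : n = N
    · subst h
      have h1 : (1 : ℝ) ∈ primeToDenom (p n) (hp n hn) :=
        ⟨1, (hp n hn).one_lt.ne' ∘ Nat.dvd_one.1, 1, by simp⟩
      convert add_mem h1 ht' using 1
      rw [Multiset.count_cons_self, ha n]
      push_cast
      ring
    · have hna : a n ∈ primeToDenom (p N) (hp N hN) := by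
        refine ⟨p n, fun hd => h ?_, p n + (-1) ^ n, prime_mul_alternating hp ha hn⟩
        exact hinj hn hN ((Nat.prime_dvd_prime_iff_eq (hp N hN) (hp n hn)).1 hd).symm
      rw [Multiset.count_cons_of_ne (Ne.symm h), add_sub_assoc]
      exact add_mem hna ht'

/-- If `a N` occurs in a sum of `a n`s, then `p N` divides the denominator of the sum or is at most
twice the sum. -/
theorem dvd_or_le_of_mem (hp : ∀ n ∈ Set.Ici 1, (p n).Prime)
    (hinj : Set.InjOn p (Set.Ici 1)) (ha : ∀ n, a n = 1 + (-1) ^ n / (p n : ℝ))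
    {t : Multiset ℕ} (ht : ∀ n ∈ t, n ∈ Set.Ici 1) {d : ℕ} {z : ℤ}
    (hd : d * (t.map a).sum = z) {N : ℕ} (hN : N ∈ t) :
    p N ∣ d ∨ (p N : ℝ) ≤ 2 * (t.map a).sum := by
  by_cases hdvd : p N ∣ d
  · exact Or.inl hdvd
  right
  have hN1 := ht N hN
  have hq : (t.map a).sum ∈ primeToDenom (p N) (hp N hN1) := ⟨d, hdvd, z, hd⟩
  have hc := sub_mem hq (sum_sub_count_mem_primeToDenom hp hinj ha hN1 ht)
  rw [sub_sub_cancel] at hc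
  have hc' : (t.count N : ℝ) / p N ∈ primeToDenom (p N) (hp N hN1) := by
    rcases neg_one_pow_eq_or ℝ N with h | h <;> rw [h] at hc
    · simpa using hc
    · rwa [neg_one_mul, neg_mem_iff] at hc
  have hle := Nat.le_of_dvd (Multiset.count_pos.2 hN) (dvd_of_div_mem_primeToDenom (hp N hN1) hc')
  have hcard : (p N : ℝ) ≤ t.card := by exact_mod_cast hle.trans (Multiset.count_le_card N t)
  exact hcard.trans (card_le_two_mul_sum hp ha ht)

theorem exists_denom (hp : ∀ n ∈ Set.Ici 1, (p n).Prime)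
    (ha : ∀ n, a n = 1 + (-1) ^ n / (p n : ℝ)) {t : Multiset ℕ}
    (ht : ∀ n ∈ t, n ∈ Set.Ici 1) :
    ∃ d : ℕ, 0 < d ∧ ∃ z : ℤ, d * (t.map a).sum = z := by
  induction t using Multiset.induction_on with
  | empty => exact ⟨1, one_pos, 0, by simp⟩
  | cons n t ih =>
    obtain ⟨d, hd, z, hz⟩ := ih fun m hm => ht m (Multiset.mem_cons_of_mem hm)
    have hn := ht n (Multiset.mem_cons_self n t)
    refine ⟨p n * d, mul_pos (hp n hn).pos hd, d * (p n + (-1) ^ n) + p n * z, ?_⟩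
    rw [Int.cast_add, Int.cast_mul, Int.cast_mul, ← prime_mul_alternating hp ha hn, ← hz,
      Multiset.map_cons, Multiset.sum_cons]
    push_cast
    ring

/-- Only finitely many of the generators `a n` divide a given element. -/
theorem finite_generators_dvd (hp : ∀ n ∈ Set.Ici 1, (p n).Prime)
    (hinj : Set.InjOn p (Set.Ici 1)) (ha : ∀ n, a n = 1 + (-1) ^ n / (p n : ℝ))
    {q : ℝ} (hq : q ∈ AddSubmonoid.closure (a '' Set.Ici 1)) :
    {n | n ∈ Set.Ici 1 ∧ q - a n ∈ AddSubmonoid.closure (a '' Set.Ici 1)}.Finite := by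
  obtain ⟨s, hs, rfl⟩ := exists_index_multiset_of_mem_closure hq
  obtain ⟨d, hd, z, hz⟩ := exists_denom hp ha hs
  obtain ⟨B, hB⟩ := exists_nat_ge (2 * (s.map a).sum)
  refine Set.Finite.of_finite_image ((Set.finite_Iic (max d B)).subset ?_)
    (hinj.mono fun n hn => hn.1)
  rintro _ ⟨n, ⟨hn, hqn⟩, rfl⟩
  obtain ⟨t, ht, htq⟩ := exists_index_multiset_of_mem_closure hqn
  have hsum : ((n ::ₘ t).map a).sum = (s.map a).sum := by
    rw [Multiset.map_cons, Multiset.sum_cons, htq, add_sub_cancel]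
  have ht' : ∀ m ∈ n ::ₘ t, m ∈ Set.Ici 1 := by
    intro m hm
    rcases Multiset.mem_cons.1 hm with rfl | hm
    exacts [hn, ht m hm]
  rw [← hsum] at hz hB
  rcases dvd_or_le_of_mem hp hinj ha ht' hz (Multiset.mem_cons_self n t) with h | h
  · exact le_max_of_le_left (Nat.le_of_dvd hd h)
  · exact le_max_of_le_right (by exact_mod_cast h.trans hB)

end AlternatingPrime

/-- For a strictly increasing sequence of primes `(p_n)_{n ≥ 1}` and
`a_n := 1 + (-1)^n / p_n`, in the positive monoid `M` generated by `{a_n : n ≥ 1}`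
every nonzero `q ∈ M` is divisible by only finitely many atoms, and consequently
`M` is an FFM. -/
theorem alternating_prime_monoid_isFFM
    (p : ℕ → ℕ) (hp : ∀ n ∈ Set.Ici 1, (p n).Prime)
    (hmono : StrictMonoOn p (Set.Ici 1))
    (a : ℕ → ℝ) (ha : ∀ n, a n = 1 + (-1) ^ n / (p n : ℝ))
    (M : AddSubmonoid ℝ) (hgen : M = AddSubmonoid.closure (a '' Set.Ici 1)) :
    (∀ q ∈ M, q ≠ 0 → {x : ℝ | IsAddAtom (M : Set ℝ) x ∧ q - x ∈ M}.Finite) ∧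
    IsFFM (M : Set ℝ) := by
  subst hgen
  have hinj : Set.InjOn p (Set.Ici 1) := hmono.injOn
  have hlow : ∀ x ∈ AddSubmonoid.closure (a '' Set.Ici 1), x ≠ 0 → 1 / 2 ≤ x := by
    intro x hx h0
    obtain ⟨t, ht, rfl⟩ := exists_index_multiset_of_mem_closure hx
    have hcard : 1 ≤ t.card := Multiset.card_pos.2 fun h => h0 (by simp [h])
    have hcard' : (1 : ℝ) ≤ t.card := by exact_mod_cast hcard
    linarith [card_le_two_mul_sum hp ha ht]
  have hfin : ∀ q ∈ AddSubmonoid.closure (a '' Set.Ici 1),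
      {x : ℝ | IsAddAtom (AddSubmonoid.closure (a '' Set.Ici 1) : Set ℝ) x ∧
        q - x ∈ AddSubmonoid.closure (a '' Set.Ici 1)}.Finite := by
    intro q hq
    refine ((finite_generators_dvd hp hinj ha hq).image a).subset fun x ⟨hx, hqx⟩ => ?_
    obtain ⟨n, hn, rfl⟩ := hx.mem_of_closure
    exact ⟨n, ⟨hn, hqx⟩, rfl⟩
  exact ⟨fun q hq _ => hfin q hq, isFFM_of_finite_atoms one_half_pos hlow hfin⟩
end
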